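/- Let n ≥ 4 be a natural number and let a be a real number with 1 < a < n(n+1)/(2n+1) − 1. Then f_a has exactly 2n + 1 zeros: the set {z ∈ ℂ, z ≠ 0 : f_a(z) = 0} has exactly 2n + 1 elements. -/

import Mathlib

/-- The family of complex-valued harmonic functions
`f_a(z) = (a/(n+1))·z^(n+1) − (1/n)·z^(−n) + (1/(n+1))·(conj z)^(n+1) − (a/n)·(conj z)^(−n) − 1`. -/
noncomputable def fa (n : ℕ) (a : ℝ) (z : ℂ) : ℂ :=
  ((a : ℂ) / ((n : ℂ) + 1)) * z ^ (n + 1) - (1 / (n : ℂ)) * z ^ (-(n : ℤ)) +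
    (1 / ((n : ℂ) + 1)) * (starRingEnd ℂ z) ^ (n + 1) -
    ((a : ℂ) / (n : ℂ)) * (starRingEnd ℂ z) ^ (-(n : ℤ)) - 1

theorem StrictConcaveOn.not_three_level {s : Set ℝ} {h : ℝ → ℝ} (hh : StrictConcaveOn ℝ s h)
    {x y z : ℝ} (hx : x ∈ s) (hz : z ∈ s) (hxy : x < y) (hyz : y < z)
    (e₁ : h x = h y) (e₂ : h y = h z) : False := by
  have := hh.slope_anti_adjacent hx hz hxy hyz
  simp [e₁, e₂] at this

theorem StrictConcaveOn.eq_or_eq_of_level {s : Set ℝ} {h : ℝ → ℝ} (hh : StrictConcaveOn ℝ s h)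
    {p q x : ℝ} (hp : p ∈ s) (hq : q ∈ s) (hx : x ∈ s) (hpq : p < q)
    (e₁ : h p = h q) (e₂ : h x = h q) : x = p ∨ x = q := by
  by_contra! hne
  rcases lt_or_gt_of_ne hne.1 with h1 | h1
  · exact hh.not_three_level hx hq h1 hpq (e₂.trans e₁.symm) e₁
  rcases lt_or_gt_of_ne hne.2 with h2 | h2
  · exact hh.not_three_level hp hq h1 h2 (e₁.trans e₂.symm) e₂
  · exact hh.not_three_level hp hx hpq h2 e₁ e₂.symm

theorem StrictConcaveOn.pos_const_mul {s : Set ℝ} {h : ℝ → ℝ} (hh : StrictConcaveOn ℝ s h)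
    {r : ℝ} (hr : 0 < r) : StrictConcaveOn ℝ s (fun x => r * h x) := by
  refine ⟨hh.1, fun x hx y hy hxy a b ha hb hab => ?_⟩
  have := mul_lt_mul_of_pos_left (hh.2 hx hy hxy ha hb hab) hr
  simp only [smul_eq_mul] at this ⊢
  linarith

theorem abs_sin_nat_mul_le {t : ℝ} (ht : 0 < Real.sin t) (m : ℕ) :
    |Real.sin (m * t)| ≤ m * Real.sin t := by
  induction m with
  | zero => simp
  | succ m ih =>
    have h1 : |Real.sin (m * t) * Real.cos t| ≤ m * Real.sin t := by
      rw [abs_mul]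
      nlinarith [Real.abs_cos_le_one t, abs_nonneg (Real.sin (m * t)), abs_nonneg (Real.cos t)]
    have h2 : |Real.cos (m * t) * Real.sin t| ≤ Real.sin t := by
      rw [abs_mul, abs_of_pos ht]
      nlinarith [Real.abs_cos_le_one (m * t)]
    push_cast
    rw [add_mul, one_mul, Real.sin_add]
    linarith [abs_add_le (Real.sin (m * t) * Real.cos t) (Real.cos (m * t) * Real.sin t)]

theorem abs_sin_nat_mul_lt {t : ℝ} (ht : 0 < Real.sin t) {m : ℕ} (hm : 2 ≤ m) :
    |Real.sin (m * t)| < m * Real.sin t := by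
  obtain ⟨k, rfl⟩ : ∃ k, m = k + 1 := ⟨m - 1, by omega⟩
  have hk : (1 : ℝ) ≤ k := by exact_mod_cast (by omega : 1 ≤ k)
  have hc : |Real.cos t| < 1 := by
    rw [← sq_lt_one_iff_abs_lt_one]
    nlinarith [Real.sin_sq_add_cos_sq t]
  have h1 : |Real.sin (k * t) * Real.cos t| < k * Real.sin t := by
    rw [abs_mul]
    have := mul_le_mul_of_nonneg_right (abs_sin_nat_mul_le ht k) (abs_nonneg (Real.cos t))
    have h0 : 0 < k * Real.sin t := by positivity
    nlinarith
  have h2 : |Real.cos (k * t) * Real.sin t| ≤ Real.sin t := by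
    rw [abs_mul, abs_of_pos ht]
    nlinarith [Real.abs_cos_le_one (k * t)]
  push_cast
  rw [add_mul, one_mul, Real.sin_add]
  linarith [abs_add_le (Real.sin (k * t) * Real.cos t) (Real.cos (k * t) * Real.sin t)]

theorem hasDerivAt_log_neg_sin_mul {m t : ℝ} (h : Real.sin (m * t) ≠ 0) :
    HasDerivAt (fun t => Real.log (-Real.sin (m * t)))
      (m * (Real.cos (m * t) / Real.sin (m * t))) t := by
  have h1 : HasDerivAt (fun t => m * t) m t := by simpa using (hasDerivAt_id t).const_mul m
  convert (h1.sin.fun_neg).log (neg_ne_zero.2 h) using 1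
  rw [neg_div_neg_eq]
  ring

theorem hasDerivAt_cot_mul {m t : ℝ} (h : Real.sin (m * t) ≠ 0) :
    HasDerivAt (fun t => m * (Real.cos (m * t) / Real.sin (m * t)))
      (-m ^ 2 / Real.sin (m * t) ^ 2) t := by
  have h1 : HasDerivAt (fun t => m * t) m t := by simpa using (hasDerivAt_id t).const_mul m
  refine ((h1.cos.fun_div h1.sin h).const_mul m).congr_deriv ?_
  rw [← mul_div_assoc]
  congr 1
  linear_combination -m ^ 2 * Real.sin_sq_add_cos_sq (m * t)

theorem strictConcaveOn_log_sin_ratio {m : ℕ} (hm : 2 ≤ m) {u v : ℝ}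
    (h0 : ∀ t ∈ Set.Ioo u v, 0 < Real.sin t) (h1 : ∀ t ∈ Set.Ioo u v, Real.sin (m * t) < 0) :
    StrictConcaveOn ℝ (Set.Ioo u v)
      (fun t => Real.log (-Real.sin (m * t)) - Real.log (Real.sin t)) := by
  have d1 : ∀ t ∈ Set.Ioo u v,
      HasDerivAt (fun t : ℝ => Real.log (-Real.sin (m * t)) - Real.log (Real.sin t))
        (m * (Real.cos (m * t) / Real.sin (m * t)) - 1 * (Real.cos (1 * t) / Real.sin (1 * t))) t := by
    intro t ht
    have h := hasDerivAt_log_neg_sin_mul (m := 1) (t := t) (by simpa using (h0 t ht).ne')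
    simp only [Real.log_neg_eq_log, one_mul] at h
    simpa using (hasDerivAt_log_neg_sin_mul (h1 t ht).ne).fun_sub h
  refine strictConcaveOn_of_deriv2_neg (convex_Ioo u v)
    (fun t ht => (d1 t ht).continuousAt.continuousWithinAt) ?_
  rw [interior_Ioo]
  intro t ht
  have e : deriv (fun t : ℝ => Real.log (-Real.sin (m * t)) - Real.log (Real.sin t)) =ᶠ[nhds t]
      fun t => m * (Real.cos (m * t) / Real.sin (m * t))
        - 1 * (Real.cos (1 * t) / Real.sin (1 * t)) := by
    filter_upwards [isOpen_Ioo.mem_nhds ht] with x hx using (d1 x hx).deriv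
  have d2 := (hasDerivAt_cot_mul (h1 t ht).ne).sub
    (hasDerivAt_cot_mul (m := 1) (t := t) (by simpa using (h0 t ht).ne'))
  have d3 : deriv^[2] (fun t : ℝ => Real.log (-Real.sin (m * t)) - Real.log (Real.sin t)) t = _ :=
    e.deriv_eq.trans d2.deriv
  rw [d3]
  have hs := h0 t ht
  have hm' := h1 t ht
  have hlt := abs_sin_nat_mul_lt hs hm
  rw [abs_of_neg hm'] at hlt
  have : (1 : ℝ) / Real.sin t ^ 2 < m ^ 2 / Real.sin (m * t) ^ 2 := by
    rw [div_lt_div_iff₀ (by positivity) (sq_pos_of_ne_zero hm'.ne), one_mul, ← mul_pow, ← neg_sq]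
    exact pow_lt_pow_left₀ hlt (by linarith) two_ne_zero
  simp only [one_mul, one_pow, neg_div]
  linarith

/-- The ratio `-κ sin (m t) / sin t`. -/
noncomputable def sinRatio (κ : ℝ) (m : ℕ) (t : ℝ) : ℝ := κ * (-Real.sin (m * t) / Real.sin t)

theorem log_sinRatio {κ t : ℝ} {m : ℕ} (hκ : 0 < κ) (h0 : 0 < Real.sin t)
    (h1 : Real.sin (m * t) < 0) : Real.log (sinRatio κ m t) =
      Real.log κ + (Real.log (-Real.sin (m * t)) - Real.log (Real.sin t)) := by
  rw [sinRatio, Real.log_mul hκ.ne' (div_ne_zero (neg_ne_zero.2 h1.ne) h0.ne'),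
    Real.log_div (neg_ne_zero.2 h1.ne) h0.ne']

theorem sinRatio_pos {κ t : ℝ} {m : ℕ} (hκ : 0 < κ) (h0 : 0 < Real.sin t)
    (h1 : Real.sin (m * t) < 0) : 0 < sinRatio κ m t :=
  mul_pos hκ (div_pos (neg_pos.2 h1) h0)

theorem sinRatio_level_eq_or_eq {κ μ : ℝ} (hκ : 0 < κ) (hμ : 0 < μ) {n : ℕ} (hn : 2 ≤ n) {u v : ℝ}
    (h0 : ∀ t ∈ Set.Ioo u v, 0 < Real.sin t) (h1 : ∀ t ∈ Set.Ioo u v, Real.sin (n * t) < 0)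
    (h2 : ∀ t ∈ Set.Ioo u v, Real.sin ((n + 1 : ℕ) * t) < 0) {p q x : ℝ}
    (hp : p ∈ Set.Ioo u v) (hq : q ∈ Set.Ioo u v) (hx : x ∈ Set.Ioo u v) (hpq : p < q)
    (ep : sinRatio κ n p ^ n * sinRatio μ (n + 1) p ^ (n + 1) = 1)
    (eq : sinRatio κ n q ^ n * sinRatio μ (n + 1) q ^ (n + 1) = 1)
    (ex : sinRatio κ n x ^ n * sinRatio μ (n + 1) x ^ (n + 1) = 1) : x = p ∨ x = q := by
  have hc := ((strictConcaveOn_log_sin_ratio hn h0 h1).pos_const_mul (r := (n : ℝ))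
    (by exact_mod_cast (by omega : 0 < n))).add
    ((strictConcaveOn_log_sin_ratio (by omega) h0 h2).pos_const_mul (r := ((n + 1 : ℕ) : ℝ))
    (by exact_mod_cast (by omega : 0 < n + 1)))
  have key : ∀ y ∈ Set.Ioo u v, sinRatio κ n y ^ n * sinRatio μ (n + 1) y ^ (n + 1) = 1 →
      n * (Real.log (-Real.sin (n * y)) - Real.log (Real.sin y)) +
      (n + 1 : ℕ) * (Real.log (-Real.sin ((n + 1 : ℕ) * y)) - Real.log (Real.sin y)) =
      - (n * Real.log κ + (n + 1 : ℕ) * Real.log μ) := by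
    intro y hy e
    have e' := congrArg Real.log e
    rw [Real.log_mul (pow_ne_zero _ (sinRatio_pos hκ (h0 y hy) (h1 y hy)).ne')
      (pow_ne_zero _ (sinRatio_pos hμ (h0 y hy) (h2 y hy)).ne'), Real.log_pow, Real.log_pow,
      log_sinRatio hκ (h0 y hy) (h1 y hy), log_sinRatio hμ (h0 y hy) (h2 y hy), Real.log_one] at e'
    linarith
  refine hc.eq_or_eq_of_level hp hq hx hpq ?_ ?_
  · simpa using (key p hp ep).trans (key q hq eq).symm
  · simpa using (key x hx ex).trans (key q hq eq).symm

theorem exists_sinRatio_one_lt {n : ℕ} (hn : 2 ≤ n) {c : ℝ} (hc : 1 / (n : ℝ) + 1 / (n + 1) < c)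
    {u v : ℝ} (huv : u < v)
    (h0 : ∀ t ∈ Set.Icc u v, 0 < Real.sin t)
    (h2 : ∀ t ∈ Set.Ioo u v, Real.sin ((n + 1 : ℕ) * t) < 0)
    (hu : Real.sin (n * u) = 0) (hv : Real.sin ((n + 1 : ℕ) * v) = 0)
    (hu' : Real.sin ((n + 1 : ℕ) * u) < 0) (hv' : Real.sin (n * v) < 0) :
    ∃ t ∈ Set.Ioo u v,
      1 < sinRatio ((n + 1) * c) n t ^ n * sinRatio (n * c) (n + 1) t ^ (n + 1) := by
  have hn0 : (0 : ℝ) < n := by exact_mod_cast (by omega : 0 < n)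
  have hc0 : 0 < c := lt_trans (by positivity) hc
  obtain ⟨t, ht, e⟩ : ∃ t ∈ Set.Ioo u v,
      (n + 1) * Real.sin (n * t) - n * Real.sin ((n + 1 : ℕ) * t) = 0 := by
    have := intermediate_value_Ioo' huv.le
      (f := fun t : ℝ => (n + 1) * Real.sin (n * t) - n * Real.sin ((n + 1 : ℕ) * t))
      (by fun_prop)
    refine this ⟨?_, ?_⟩
    · simp only [hv]; nlinarith
    · simp only [hu]; nlinarith
  refine ⟨t, ht, ?_⟩
  have hs := h0 t ⟨ht.1.le, ht.2.le⟩
  have e1 : sinRatio ((n + 1) * c) n t = sinRatio (n * c) (n + 1) t := by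
    unfold sinRatio
    field_simp
    rw [mul_comm t]
    linarith
  rw [e1]
  have : 1 < sinRatio (n * c) (n + 1) t := by
    set T := sinRatio (n * c) (n + 1) t with hT
    have hTpos : 0 < T := sinRatio_pos (by positivity) hs (h2 t ht)
    have a1 : T * Real.sin t = -(n + 1) * c * Real.sin (n * t) := by
      rw [← e1]; unfold sinRatio; field_simp
    have a2 : T * Real.sin t = - n * c * Real.sin (n * t + t) := by
      rw [hT]; unfold sinRatio; push_cast; field_simp
    -- the triangle inequality `c ≤ T / (n + 1) + T / n` in coordinates
    rw [Real.sin_add] at a2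
    have hle : c ^ 2 ≤ (T * (1 / (n : ℝ) + 1 / (n + 1))) ^ 2 := by
      have b1 : Real.sin (n * t) * c = - (T / (n + 1)) * Real.sin t := by
        field_simp; linarith
      have b2 : Real.cos (n * t) * c = (T / (n + 1)) * Real.cos t - T / n := by
        have : Real.sin t * (Real.cos (n * t) * c) =
            Real.sin t * ((T / (n + 1)) * Real.cos t - T / n) := by
          have b3 : (Real.sin (n * t) * Real.cos t + Real.cos (n * t) * Real.sin t) * c
            = - (T / n) * Real.sin t := by field_simp; linarith
          linear_combination b3 - Real.cos t * b1
        exact mul_left_cancel₀ hs.ne' this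
      have b4 : c ^ 2 = (T / (n + 1)) ^ 2 + (T / n) ^ 2
          - 2 * (T / (n + 1)) * (T / n) * Real.cos t := by
        have q1 := Real.sin_sq_add_cos_sq (n * t)
        have q2 := Real.sin_sq_add_cos_sq t
        calc c ^ 2 = (Real.sin (n * t) * c) ^ 2 + (Real.cos (n * t) * c) ^ 2 := by
              linear_combination (-c ^ 2) * q1
          _ = _ := by rw [b1, b2]; linear_combination (T / (n + 1)) ^ 2 * q2
      have b5 : T * (1 / (n : ℝ) + 1 / (n + 1)) = T / n + T / (n + 1) := by ring
      rw [b5, b4]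
      have : 0 < (T / (n + 1)) * (T / n) := by positivity
      nlinarith [Real.neg_one_le_cos t]
    have hle' := (pow_le_pow_iff_left₀ hc0.le (by positivity) two_ne_zero).1 hle
    by_contra! hT1
    have hpos : 0 < 1 / (n : ℝ) + 1 / (n + 1) := by positivity
    nlinarith
  rw [← pow_add]
  exact one_lt_pow₀ this (by omega)

theorem exists_sinRatio_level_pair {n : ℕ} (hn : 2 ≤ n) {c : ℝ}
    (hc : 1 / (n : ℝ) + 1 / (n + 1) < c) {u v : ℝ} (huv : u < v)
    (h0 : ∀ t ∈ Set.Icc u v, 0 < Real.sin t) (h1 : ∀ t ∈ Set.Ioo u v, Real.sin (n * t) < 0)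
    (h2 : ∀ t ∈ Set.Ioo u v, Real.sin ((n + 1 : ℕ) * t) < 0)
    (hu : Real.sin (n * u) = 0) (hv : Real.sin ((n + 1 : ℕ) * v) = 0)
    (hu' : Real.sin ((n + 1 : ℕ) * u) < 0) (hv' : Real.sin (n * v) < 0) :
    ∃ p q : ℝ, p < q ∧ p ∈ Set.Ioo u v ∧ q ∈ Set.Ioo u v ∧ ∀ t ∈ Set.Ioo u v,
      sinRatio ((n + 1) * c) n t ^ n * sinRatio (n * c) (n + 1) t ^ (n + 1) = 1 ↔
        t = p ∨ t = q := by
  have hn0 : (0 : ℝ) < n := by exact_mod_cast (by omega : 0 < n)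
  have hc0 : 0 < c := lt_trans (by positivity) hc
  obtain ⟨t, ht, h⟩ := exists_sinRatio_one_lt hn hc huv h0 h2 hu hv hu' hv'
  set G : ℝ → ℝ := fun t =>
    sinRatio ((n + 1) * c) n t ^ n * sinRatio (n * c) (n + 1) t ^ (n + 1) with hG
  have hcont : ContinuousOn G (Set.Icc u v) := by
    intro x hx
    have := (h0 x hx).ne'
    apply ContinuousAt.continuousWithinAt
    simp only [hG]
    unfold sinRatio
    fun_prop (disch := assumption)
  have Gu : G u = 0 := by simp [hG, sinRatio, hu]; omega
  have Gv : G v = 0 := by simp only [hG, sinRatio, hv]; simp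
  obtain ⟨p, hp, ep⟩ := intermediate_value_Ioo ht.1.le
    (hcont.mono (Set.Icc_subset_Icc_right ht.2.le)) (show (1 : ℝ) ∈ _ from ⟨by simp [Gu], h⟩)
  obtain ⟨q, hq, eq⟩ := intermediate_value_Ioo' ht.2.le
    (hcont.mono (Set.Icc_subset_Icc_left ht.1.le)) (show (1 : ℝ) ∈ _ from ⟨by simp [Gv], h⟩)
  have hp' : p ∈ Set.Ioo u v := ⟨hp.1, hp.2.trans ht.2⟩
  have hq' : q ∈ Set.Ioo u v := ⟨ht.1.trans hq.1, hq.2⟩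
  have hpq := hp.2.trans hq.1
  refine ⟨p, q, hpq, hp', hq', fun x hx => ⟨fun ex => ?_, ?_⟩⟩
  · exact sinRatio_level_eq_or_eq (by positivity) (by positivity) hn
      (fun t ht => h0 t ⟨ht.1.le, ht.2.le⟩) h1 h2 hp' hq' hx hpq ep eq ex
  · rintro (rfl | rfl)
    exacts [ep, eq]

theorem sin_neg_of_mem_half_period {k : ℕ} {x : ℝ} (h1 : (2 * k - 1) * Real.pi < x)
    (h2 : x < 2 * k * Real.pi) : Real.sin x < 0 := by
  rw [← Real.sin_sub_nat_mul_two_pi x k]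
  exact Real.sin_neg_of_neg_of_neg_pi_lt (by linarith) (by linarith)

theorem sin_two_mul_sub_one_mul_pi (k : ℕ) : Real.sin ((2 * k - 1) * Real.pi) = 0 := by
  have := Real.sin_int_mul_pi (2 * k - 1)
  push_cast at this
  exact this

theorem sin_two_mul_mul_pi (k : ℕ) : Real.sin (2 * k * Real.pi) = 0 := by
  have := Real.sin_nat_mul_pi (2 * k)
  push_cast at this
  exact this

/-- The arcs of `(0, π)` on which both `sin (n t)` and `sin ((n + 1) t)` are negative. -/
def negArc (n k : ℕ) : Set ℝ :=
  Set.Ioo ((2 * k - 1) * Real.pi / n) (2 * k * Real.pi / (n + 1))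

theorem mem_negArc_iff {n k : ℕ} (hn : 0 < n) {t : ℝ} : t ∈ negArc n k ↔
    (2 * k - 1) * Real.pi < n * t ∧ (n + 1 : ℕ) * t < 2 * k * Real.pi := by
  have hn0 : (0 : ℝ) < n := by exact_mod_cast hn
  rw [negArc, Set.mem_Ioo, div_lt_iff₀' hn0, lt_div_iff₀' (by positivity)]
  push_cast
  rfl

theorem bounds_of_mem_negArc {n k : ℕ} (hn : 0 < n) (hk : 1 ≤ k) (hkn : 2 * k ≤ n) {t : ℝ}
    (ht : t ∈ negArc n k) : 0 < t ∧ t < Real.pi ∧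
      n * t < 2 * k * Real.pi ∧ (2 * k - 1) * Real.pi < (n + 1 : ℕ) * t := by
  have hn0 : (0 : ℝ) < n := by exact_mod_cast hn
  have hk0 : (1 : ℝ) ≤ k := by exact_mod_cast hk
  have hkn0 : 2 * (k : ℝ) ≤ n := by exact_mod_cast hkn
  obtain ⟨h1, h2⟩ := (mem_negArc_iff hn).1 ht
  have hpi := Real.pi_pos
  push_cast at h2 ⊢
  have : 0 < (n : ℝ) * t := lt_trans (by nlinarith) h1
  have ht0 : 0 < t := pos_of_mul_pos_right this hn0.le
  exact ⟨ht0, by nlinarith, by linarith, by linarith⟩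

theorem sin_neg_of_mem_negArc {n k : ℕ} (hn : 0 < n) (hk : 1 ≤ k) (hkn : 2 * k ≤ n) {t : ℝ}
    (ht : t ∈ negArc n k) : Real.sin (n * t) < 0 ∧ Real.sin ((n + 1 : ℕ) * t) < 0 := by
  have h := bounds_of_mem_negArc hn hk hkn ht
  have h' := (mem_negArc_iff hn).1 ht
  exact ⟨sin_neg_of_mem_half_period h'.1 h.2.2.1, sin_neg_of_mem_half_period h.2.2.2 h'.2⟩

theorem exists_negArc_of_sin_neg {n : ℕ} (hn : 0 < n) {t : ℝ} (ht0 : 0 < t) (ht : t < Real.pi)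
    (h1 : Real.sin (n * t) < 0) (h2 : Real.sin ((n + 1 : ℕ) * t) < 0) :
    ∃ k, 1 ≤ k ∧ 2 * k ≤ n ∧ t ∈ negArc n k := by
  have hn0 : (0 : ℝ) < n := by exact_mod_cast hn
  have hpi := Real.pi_pos
  have hp : 0 ≤ (n * t) / (2 * Real.pi) := by positivity
  have f1 := Nat.floor_le hp
  have f2 := Nat.lt_floor_add_one ((n * t) / (2 * Real.pi))
  set j := ⌊(n * t) / (2 * Real.pi)⌋₊
  rw [le_div_iff₀ (by positivity)] at f1
  rw [div_lt_iff₀ (by positivity)] at f2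
  have g1 : (2 * j + 1) * Real.pi < n * t := by
    by_contra! hle
    rw [← Real.sin_sub_nat_mul_two_pi _ j] at h1
    exact h1.not_ge (Real.sin_nonneg_of_nonneg_of_le_pi (by linarith) (by linarith))
  have g2 : (n + 1 : ℕ) * t < 2 * (j + 1 : ℕ) * Real.pi := by
    by_contra! hle
    rw [← Real.sin_sub_nat_mul_two_pi _ (j + 1)] at h2
    push_cast at h2 hle
    exact h2.not_ge (Real.sin_nonneg_of_nonneg_of_le_pi (by linarith) (by linarith))
  refine ⟨j + 1, by omega, ?_, (mem_negArc_iff hn).2 ⟨by push_cast; linarith, g2⟩⟩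
  have : (2 * j + 1 : ℝ) < n := by
    have : (2 * j + 1) * Real.pi < n * Real.pi := by nlinarith
    exact lt_of_mul_lt_mul_right this hpi.le
  have : 2 * j + 1 < n := by exact_mod_cast this
  omega

theorem negArc_index_unique {n k l : ℕ} (hn : 0 < n) (hk : 1 ≤ k) (hkn : 2 * k ≤ n)
    (hl : 1 ≤ l) (hln : 2 * l ≤ n) {t : ℝ} (htk : t ∈ negArc n k) (htl : t ∈ negArc n l) :
    k = l := by
  wlog h : k < l generalizing k l
  · rcases eq_or_lt_of_le (not_lt.1 h) with h | h
    · exact h.symm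
    · exact (this hl hln hk hkn htl htk h).symm
  have h1 := (bounds_of_mem_negArc hn hk hkn htk).2.2.1
  have h2 := ((mem_negArc_iff hn).1 htl).1
  have : (k : ℝ) + 1 ≤ l := by exact_mod_cast h
  nlinarith [Real.pi_pos]

theorem ncard_sinRatio_level {n : ℕ} (hn : 2 ≤ n) {c : ℝ}
    (hc : 1 / (n : ℝ) + 1 / (n + 1) < c) :
    {t : ℝ | t ∈ Set.Ioo 0 Real.pi ∧ Real.sin (n * t) < 0 ∧ Real.sin ((n + 1 : ℕ) * t) < 0 ∧
      sinRatio ((n + 1) * c) n t ^ n * sinRatio (n * c) (n + 1) t ^ (n + 1) = 1}.ncard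
      = 2 * (n / 2) ∧
    {t : ℝ | t ∈ Set.Ioo 0 Real.pi ∧ Real.sin (n * t) < 0 ∧ Real.sin ((n + 1 : ℕ) * t) < 0 ∧
      sinRatio ((n + 1) * c) n t ^ n * sinRatio (n * c) (n + 1) t ^ (n + 1) = 1}.Finite := by
  have hn1 : 0 < n := by omega
  have hn0 : (0 : ℝ) < n := by exact_mod_cast hn1
  have key : ∀ k ∈ Finset.Icc 1 (n / 2), ∃ p q : ℝ, p < q ∧ p ∈ negArc n k ∧ q ∈ negArc n k ∧
      ∀ t ∈ negArc n k,
        sinRatio ((n + 1) * c) n t ^ n * sinRatio (n * c) (n + 1) t ^ (n + 1) = 1 ↔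
          t = p ∨ t = q := by
    intro k hk
    obtain ⟨hk1, hk2⟩ := Finset.mem_Icc.1 hk
    have hkn : 2 * k ≤ n := by omega
    have hpi := Real.pi_pos
    have hk0 : (1 : ℝ) ≤ k := by exact_mod_cast hk1
    have hkn0 : 2 * (k : ℝ) ≤ n := by exact_mod_cast hkn
    have e1 : (n : ℝ) * ((2 * k - 1) * Real.pi / n) = (2 * k - 1) * Real.pi := by field_simp
    have e2 : ((n + 1 : ℕ) : ℝ) * (2 * k * Real.pi / (n + 1)) = 2 * k * Real.pi := by
      push_cast; field_simp
    have hu0 : 0 < (2 * k - 1) * Real.pi / n := by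
      have : (0 : ℝ) < 2 * k - 1 := by linarith
      positivity
    have hvpi : 2 * k * Real.pi / (n + 1) < Real.pi := by
      rw [div_lt_iff₀ (by positivity)]; nlinarith
    have huv : (2 * k - 1) * Real.pi / n < 2 * k * Real.pi / (n + 1) := by
      rw [div_lt_div_iff₀ (by positivity) (by positivity)]; nlinarith
    refine exists_sinRatio_level_pair hn hc huv ?_ ?_ ?_ ?_ ?_ ?_ ?_
    · exact fun t ht => Real.sin_pos_of_pos_of_lt_pi (by linarith [ht.1]) (by linarith [ht.2])
    · exact fun t ht => (sin_neg_of_mem_negArc hn1 hk1 hkn ht).1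
    · exact fun t ht => (sin_neg_of_mem_negArc hn1 hk1 hkn ht).2
    · rw [e1]; exact sin_two_mul_sub_one_mul_pi k
    · rw [e2]; exact sin_two_mul_mul_pi k
    · refine sin_neg_of_mem_half_period (k := k) ?_ ?_
      · push_cast; linarith
      · rw [← e2]; gcongr
    · refine sin_neg_of_mem_half_period (k := k) ?_ ?_
      · rw [← e1]; gcongr
      · push_cast at e2; linarith [hu0.trans huv]
  choose! p q hpq hp hq hiff using key
  have hset : {t : ℝ | t ∈ Set.Ioo 0 Real.pi ∧ Real.sin (n * t) < 0 ∧
      Real.sin ((n + 1 : ℕ) * t) < 0 ∧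
      sinRatio ((n + 1) * c) n t ^ n * sinRatio (n * c) (n + 1) t ^ (n + 1) = 1} =
      ((Finset.Icc 1 (n / 2)).biUnion fun k => ({p k, q k} : Finset ℝ) : Finset ℝ) := by
    ext t
    simp only [Set.mem_ofPred_eq, Finset.coe_biUnion, Set.mem_iUnion, Finset.mem_coe,
      Finset.mem_insert, Finset.mem_singleton]
    constructor
    · rintro ⟨ht, h1, h2, e⟩
      obtain ⟨k, hk1, hkn, hk⟩ := exists_negArc_of_sin_neg hn1 ht.1 ht.2 h1 h2
      have hk' : k ∈ Finset.Icc 1 (n / 2) := Finset.mem_Icc.2 ⟨hk1, by omega⟩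
      exact ⟨k, hk', (hiff k hk' t hk).1 e⟩
    · rintro ⟨k, hk, h⟩
      have hkt : t ∈ negArc n k := by
        rcases h with rfl | rfl
        exacts [hp k hk, hq k hk]
      obtain ⟨hk1, hk2⟩ := Finset.mem_Icc.1 hk
      have hb := bounds_of_mem_negArc hn1 hk1 (by omega) hkt
      have hs := sin_neg_of_mem_negArc hn1 hk1 (by omega) hkt
      exact ⟨⟨hb.1, hb.2.1⟩, hs.1, hs.2, (hiff k hk t hkt).2 h⟩
  rw [hset]
  refine ⟨?_, Finset.finite_toSet _⟩
  rw [Set.ncard_coe_finset, Finset.card_biUnion, Finset.sum_congr rfl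
    (fun k hk => Finset.card_pair (hpq k hk).ne)]
  · simp [mul_comm]
  · intro k hk l hl hkl
    rw [Function.onFun, Finset.disjoint_left]
    intro t htk htl
    have mem : ∀ k ∈ Finset.Icc 1 (n / 2), t ∈ ({p k, q k} : Finset ℝ) → t ∈ negArc n k := by
      intro k hk h
      rcases Finset.mem_insert.1 h with h | h
      · exact h ▸ hp k hk
      · exact Finset.mem_singleton.1 h ▸ hq k hk
    have hk' := Finset.mem_Icc.1 hk
    have hl' := Finset.mem_Icc.1 hl
    exact hkl (negArc_index_unique hn1 hk'.1 (by omega) hl'.1 (by omega)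
      (mem k hk htk) (mem l hl htl))

/-- The equation `z ^ (n + 1) / (n + 1) - conj z ^ (-n) / n = c`, to which `f_a(z) = 0` reduces
for `c = 1 / (a + 1)`. -/
def ReducedEqn (n : ℕ) (c : ℝ) (z : ℂ) : Prop :=
  z ^ (n + 1) / ((n : ℂ) + 1) - (starRingEnd ℂ z ^ n)⁻¹ / n = c

theorem fa_eq_zero_iff {n : ℕ} {a : ℝ} (ha : 1 < a) (z : ℂ) :
    fa n a z = 0 ↔ ReducedEqn n (1 / (a + 1)) z := by
  have ha1 : (a : ℂ) - 1 ≠ 0 := by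
    exact_mod_cast (by linarith : a - 1 ≠ 0 )
  have ha2 : (a : ℂ) + 1 ≠ 0 := by
    exact_mod_cast (by linarith : a + 1 ≠ 0)
  set w : ℂ := z ^ (n + 1) / ((n : ℂ) + 1) - (starRingEnd ℂ z ^ n)⁻¹ / n with hw
  have hcw : starRingEnd ℂ w = starRingEnd ℂ z ^ (n + 1) / ((n : ℂ) + 1) - (z ^ n)⁻¹ / n := by
    simp [hw]
  have hfa : fa n a z = a * w + starRingEnd ℂ w - 1 := by
    rw [hcw, hw, fa, zpow_neg, zpow_neg, zpow_natCast, zpow_natCast]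
    ring
  have hR : ReducedEqn n (1 / (a + 1)) z ↔ w = 1 / ((a : ℂ) + 1) := by
    rw [ReducedEqn]
    push_cast
    rfl
  rw [hfa, hR]
  constructor
  · intro h
    have h' := congrArg (starRingEnd ℂ) h
    simp only [map_sub, map_add, map_mul, Complex.conj_ofReal, Complex.conj_conj, map_one,
      map_zero] at h'
    have hreal : starRingEnd ℂ w = w := by
      have : ((a : ℂ) - 1) * (starRingEnd ℂ w - w) = 0 := by linear_combination h' - h
      rcases mul_eq_zero.1 this with h0 | h0
      · exact absurd h0 ha1
      · exact sub_eq_zero.1 h0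
    rw [hreal] at h
    rw [eq_div_iff ha2]
    linear_combination h
  · intro h
    have : starRingEnd ℂ w = w := by
      rw [h]; simp
    rw [this, h]
    field_simp
    ring

theorem reducedEqn_conj {n : ℕ} {c : ℝ} {z : ℂ} (h : ReducedEqn n c z) :
    ReducedEqn n c (starRingEnd ℂ z) := by
  have := congrArg (starRingEnd ℂ) h
  simpa [ReducedEqn] using this

theorem reducedEqn_ofReal {n : ℕ} {c x : ℝ} :
    ReducedEqn n c x ↔ x ^ (n + 1) / (n + 1) - (x ^ n)⁻¹ / n = c := by
  rw [ReducedEqn, Complex.conj_ofReal]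
  norm_cast

theorem reducedEqn_polar {n : ℕ} {c r t : ℝ} (hr : 0 < r) :
    ReducedEqn n c (r * (Complex.cos t + Complex.sin t * Complex.I)) ↔
      r ^ (n + 1) / (n + 1) * Real.cos ((n + 1 : ℕ) * t) - (r ^ n)⁻¹ / n * Real.cos (n * t) = c ∧
      r ^ (n + 1) / (n + 1) * Real.sin ((n + 1 : ℕ) * t) - (r ^ n)⁻¹ / n * Real.sin (n * t) = 0 := by
  have h1 : ((r : ℂ) * (Complex.cos t + Complex.sin t * Complex.I)) ^ (n + 1) =
      (r ^ (n + 1) : ℝ) * ((Real.cos ((n + 1 : ℕ) * t) : ℝ)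
        + (Real.sin ((n + 1 : ℕ) * t) : ℝ) * Complex.I) := by
    rw [mul_pow, Complex.cos_add_sin_mul_I_pow]
    push_cast
    rfl
  have h2 : (starRingEnd ℂ ((r : ℂ) * (Complex.cos t + Complex.sin t * Complex.I)) ^ n)⁻¹ =
      ((r ^ n)⁻¹ : ℝ) * ((Real.cos (n * t) : ℝ) + (Real.sin (n * t) : ℝ) * Complex.I) := by
    rw [← map_pow, mul_pow, Complex.cos_add_sin_mul_I_pow]
    have e : starRingEnd ℂ ((r : ℂ) ^ n * (Complex.cos (n * t) + Complex.sin (n * t) * Complex.I))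
        = (r : ℂ) ^ n * ((Real.cos (n * t) : ℝ) - (Real.sin (n * t) : ℝ) * Complex.I) := by
      have e1 : Complex.cos (n * t) = (Real.cos (n * t) : ℝ) := by push_cast; rfl
      have e2 : Complex.sin (n * t) = (Real.sin (n * t) : ℝ) := by push_cast; rfl
      rw [e1, e2]
      simp only [map_mul, map_add, map_pow, Complex.conj_ofReal, Complex.conj_I]
      ring
    rw [e]
    refine inv_eq_of_mul_eq_one_right ?_
    have hsc : ((Real.sin (n * t) : ℝ) : ℂ) ^ 2 + ((Real.cos (n * t) : ℝ) : ℂ) ^ 2 = 1 := by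
      exact_mod_cast Real.sin_sq_add_cos_sq (n * t)
    have hrn : (r : ℂ) ^ n * ((r ^ n)⁻¹ : ℝ) = 1 := by
      exact_mod_cast mul_inv_cancel₀ (pow_pos hr n).ne'
    linear_combination ((r : ℂ) ^ n * ((r ^ n)⁻¹ : ℝ)) *
      (hsc - ((Real.sin (n * t) : ℝ) : ℂ) ^ 2 * Complex.I_sq) + hrn
  have h3 : ∀ x y : ℝ, (x : ℂ) + y * Complex.I = c ↔ x = c ∧ y = 0 := by
    intro x y
    rw [Complex.ext_iff]
    simp
  rw [ReducedEqn, h1, h2, ← h3]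
  push_cast
  constructor <;> intro h <;> linear_combination h

theorem reducedEqn_polar_iff_sinRatio {n : ℕ} (hn : 0 < n) {c r t : ℝ} (hr : 0 < r)
    (ht : 0 < Real.sin t) :
    ReducedEqn n c (r * (Complex.cos t + Complex.sin t * Complex.I)) ↔
      r ^ (n + 1) = sinRatio ((n + 1) * c) n t ∧ (r ^ n)⁻¹ = sinRatio (n * c) (n + 1) t := by
  have hn0 : (0 : ℝ) < n := by exact_mod_cast hn
  have hA : r ^ (n + 1) = sinRatio ((n + 1) * c) n t ↔
      r ^ (n + 1) / (n + 1) * Real.sin t = - c * Real.sin (n * t) := by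
    rw [sinRatio]
    field_simp
  have hB : (r ^ n)⁻¹ = sinRatio (n * c) (n + 1) t ↔
      (r ^ n)⁻¹ / n * Real.sin t = - c * Real.sin ((n + 1 : ℕ) * t) := by
    rw [sinRatio, ← mul_div_assoc, eq_div_iff ht.ne', div_mul_eq_mul_div, div_eq_iff hn0.ne']
    constructor <;> intro h <;> linear_combination h
  rw [reducedEqn_polar hr, hA, hB]
  generalize r ^ (n + 1) / (n + 1) = X
  generalize (r ^ n)⁻¹ / n = Y
  push_cast
  rw [add_mul, one_mul, Real.sin_add, Real.cos_add]
  have hsc := Real.sin_sq_add_cos_sq (n * t)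
  have hsc' := Real.sin_sq_add_cos_sq t
  generalize Real.sin (n * t) = S at *
  generalize Real.cos (n * t) = C at *
  generalize Real.sin t = s at *
  generalize Real.cos t = k at *
  constructor
  · rintro ⟨h1, h2⟩
    constructor
    · linear_combination C * h2 - S * h1 - X * s * hsc
    · linear_combination (C * k - S * s) * h2 - (S * k + C * s) * h1 - Y * s * hsc
  · rintro ⟨h1, h2⟩
    constructor
    · refine mul_left_cancel₀ ht.ne' ?_
      linear_combination (C * k - S * s) * h1 - C * h2 + c * s * hsc
    · refine mul_left_cancel₀ ht.ne' ?_
      linear_combination (S * k + C * s) * h1 - S * h2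

theorem ncard_reducedEqn_upper {n : ℕ} (hn : 2 ≤ n) {c : ℝ}
    (hc : 1 / (n : ℝ) + 1 / (n + 1) < c) :
    {z : ℂ | 0 < z.im ∧ ReducedEqn n c z}.ncard = 2 * (n / 2) ∧
    {z : ℂ | 0 < z.im ∧ ReducedEqn n c z}.Finite := by
  have hn0 : (0 : ℝ) < n := by exact_mod_cast (by omega : 0 < n)
  have hc0 : 0 < c := lt_trans (by positivity) hc
  obtain ⟨hcard, hfin⟩ := ncard_sinRatio_level hn hc
  set Θ := {t : ℝ | t ∈ Set.Ioo 0 Real.pi ∧ Real.sin (n * t) < 0 ∧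
    Real.sin ((n + 1 : ℕ) * t) < 0 ∧
    sinRatio ((n + 1) * c) n t ^ n * sinRatio (n * c) (n + 1) t ^ (n + 1) = 1} with hΘ
  set φ : ℝ → ℂ := fun t => ((sinRatio ((n + 1) * c) n t * sinRatio (n * c) (n + 1) t : ℝ) : ℂ) *
    (Complex.cos t + Complex.sin t * Complex.I) with hφ
  have hsin : ∀ t ∈ Θ, 0 < Real.sin t := fun t ht => Real.sin_pos_of_pos_of_lt_pi ht.1.1 ht.1.2
  have hpos : ∀ t ∈ Θ, 0 < sinRatio ((n + 1) * c) n t * sinRatio (n * c) (n + 1) t := fun t ht =>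
    mul_pos (sinRatio_pos (by positivity) (hsin t ht) ht.2.1)
      (sinRatio_pos (by positivity) (hsin t ht) ht.2.2.1)
  have hinj : Set.InjOn φ Θ := by
    intro t ht u hu h
    have h' := congrArg Complex.arg h
    have hpi := Real.pi_pos
    rwa [hφ, Complex.arg_mul_cos_add_sin_mul_I (hpos t ht) ⟨by linarith [ht.1.1], ht.1.2.le⟩,
      Complex.arg_mul_cos_add_sin_mul_I (hpos u hu) ⟨by linarith [hu.1.1], hu.1.2.le⟩] at h'
  have himg : {z : ℂ | 0 < z.im ∧ ReducedEqn n c z} = φ '' Θ := by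
    ext z
    constructor
    · rintro ⟨hz, he⟩
      have hz0 : z ≠ 0 := by rintro rfl; simp at hz
      have hr : 0 < ‖z‖ := norm_pos_iff.2 hz0
      have hpolar := Complex.norm_mul_cos_add_sin_mul_I z
      have harg : 0 < z.arg ∧ z.arg < Real.pi := by
        have h0 := (Complex.arg_nonneg_iff (z := z)).2 hz.le
        refine ⟨lt_of_le_of_ne h0 fun h => ?_, lt_of_le_of_ne (Complex.arg_le_pi z) fun h => ?_⟩
        · exact hz.ne' (Complex.arg_eq_zero_iff.1 h.symm).2
        · exact hz.ne' (Complex.arg_eq_pi_iff.1 h).2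
      have hs : 0 < Real.sin z.arg := Real.sin_pos_of_pos_of_lt_pi harg.1 harg.2
      rw [← hpolar, reducedEqn_polar_iff_sinRatio (by omega) hr hs] at he
      have hneg : ∀ {κ : ℝ} {m : ℕ}, 0 < κ → 0 < sinRatio κ m z.arg → Real.sin (m * z.arg) < 0 := by
        intro κ m hκ h
        have h1 := pos_of_mul_pos_right h hκ.le
        have h2 := (div_pos_iff_of_pos_right hs).1 h1
        linarith
      refine ⟨z.arg, ⟨harg, hneg (κ := (n + 1) * c) (by positivity) (he.1 ▸ by positivity),
        hneg (κ := n * c) (by positivity) (he.2 ▸ by positivity), ?_⟩, ?_⟩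
      · rw [← he.1, ← he.2]
        rw [inv_pow, ← pow_mul, ← pow_mul, mul_comm n]
        exact mul_inv_cancel₀ (pow_pos hr _).ne'
      · simp only [hφ]
        rw [← he.1, ← he.2]
        conv_rhs => rw [← hpolar]
        congr 2
        rw [pow_succ]
        field_simp
    · rintro ⟨t, ht, rfl⟩
      have hr := hpos t ht
      refine ⟨?_, ?_⟩
      · have := mul_pos hr (hsin t ht)
        simp only [hφ, Complex.im_ofReal_mul, Complex.add_im, Complex.mul_I_im,
          Complex.cos_ofReal_im, Complex.sin_ofReal_re]
        simpa using this
      · refine (reducedEqn_polar_iff_sinRatio (by omega) hr (hsin t ht)).2 ?_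
        have e := ht.2.2.2
        generalize sinRatio ((n + 1) * c) n t = A at *
        generalize sinRatio (n * c) (n + 1) t = B at *
        constructor
        · rw [mul_pow, pow_succ A]; linear_combination A * e
        · refine inv_eq_of_mul_eq_one_right ?_
          rw [mul_pow]; linear_combination e
  rw [himg, hinj.ncard_image]
  exact ⟨hcard, hfin.image φ⟩

theorem exists_unique_pos_root {n : ℕ} (hn : 0 < n) {c : ℝ} (hc : 0 < c) :
    ∃ p : ℝ, 0 < p ∧ ∀ x : ℝ, 0 < x → (x ^ (n + 1) / (n + 1) - (x ^ n)⁻¹ / n = c ↔ x = p) := by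
  have hn0 : (0 : ℝ) < n := by exact_mod_cast hn
  set g : ℝ → ℝ := fun x => x ^ (n + 1) / (n + 1) - (x ^ n)⁻¹ / n with hg
  have hmono : StrictMonoOn g (Set.Ioi 0) := by
    intro x hx y hy hxy
    have hx' : 0 < x := hx
    have hy' : 0 < y := hy
    have h1 : x ^ (n + 1) < y ^ (n + 1) := pow_lt_pow_left₀ hxy hx'.le (by omega)
    have h2 : (y ^ n)⁻¹ ≤ (x ^ n)⁻¹ := by gcongr
    simp only [hg]
    have h3 := div_lt_div_of_pos_right h1 (show (0 : ℝ) < n + 1 by positivity)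
    have h4 := div_le_div_of_nonneg_right h2 hn0.le
    linarith
  set M : ℝ := 1 + (n + 1) * (c + 1) with hM
  have hM1 : 1 < M := by have : 0 < (n + 1) * (c + 1) := by positivity
                         linarith
  have g1 : g 1 ≤ 0 := by
    simp only [hg, one_pow, inv_one, sub_nonpos]
    gcongr
    linarith
  have gM : c ≤ g M := by
    have h1 : M ≤ M ^ (n + 1) := le_self_pow₀ hM1.le (by omega)
    have h2 : c + 1 ≤ M ^ (n + 1) / (n + 1) := by
      rw [le_div_iff₀ (by positivity)]; linarith
    have h3 : (M ^ n)⁻¹ / n ≤ 1 := by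
      rw [div_le_one hn0]
      exact (inv_le_one_of_one_le₀ (one_le_pow₀ hM1.le)).trans (by exact_mod_cast hn)
    simp only [hg]
    linarith
  have hcont : ContinuousOn g (Set.Icc 1 M) := by
    intro x hx
    have : x ^ n ≠ 0 := pow_ne_zero _ (by linarith [hx.1])
    apply ContinuousAt.continuousWithinAt
    simp only [hg]
    fun_prop (disch := assumption)
  obtain ⟨p, hp, e⟩ := intermediate_value_Icc hM1.le hcont ⟨g1.trans hc.le, gM⟩
  have hp0 : 0 < p := by linarith [hp.1]
  exact ⟨p, hp0, fun x hx => ⟨fun h => hmono.injOn hx hp0 (h.trans e.symm), fun h => h ▸ e⟩⟩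

theorem exists_pair_pos_roots {n : ℕ} (hn : 0 < n) {c : ℝ}
    (hc : 1 / (n : ℝ) + 1 / (n + 1) < c) :
    ∃ p q : ℝ, 0 < p ∧ p < q ∧
      ∀ x : ℝ, 0 < x → (x ^ (n + 1) / (n + 1) + (x ^ n)⁻¹ / n = c ↔ x = p ∨ x = q) := by
  have hn0 : (0 : ℝ) < n := by exact_mod_cast hn
  have hc0 : 0 < c := lt_trans (by positivity) hc
  set g : ℝ → ℝ := fun x => x ^ (n + 1) / (n + 1) + (x ^ n)⁻¹ / n with hg
  have hconc : StrictConcaveOn ℝ (Set.Ioi 0) (fun x => - g x) := by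
    have h1 := ((strictConvexOn_pow (n := n + 1) (by omega)).subset Set.Ioi_subset_Ici_self
      (convex_Ioi 0)).neg.pos_const_mul (show (0 : ℝ) < 1 / (n + 1) by positivity)
    have h2 := (strictConvexOn_zpow (m := -(n : ℤ)) (by omega) (by omega)).neg.pos_const_mul
      (show (0 : ℝ) < 1 / n by positivity)
    refine (h1.add h2).congr fun x _ => ?_
    simp only [hg, Pi.add_apply, Pi.neg_apply, zpow_neg, zpow_natCast]
    ring
  set M : ℝ := 1 + (n + 1) * c with hM
  set m : ℝ := (1 + n * c)⁻¹ with hm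
  have hM1 : 1 < M := by have : 0 < (n + 1) * c := by positivity
                         linarith
  have hm0 : 0 < m := by positivity
  have hm1 : m < 1 := inv_lt_one_of_one_lt₀ (by have : 0 < n * c := by positivity
                                                linarith)
  have g1 : g 1 < c := by
    simp only [hg, one_pow, inv_one]
    linarith
  have gM : c < g M := by
    have h1 : M ≤ M ^ (n + 1) := le_self_pow₀ hM1.le (by omega)
    have h2 : c < M ^ (n + 1) / (n + 1) := by
      rw [lt_div_iff₀ (by positivity)]; linarith
    have h3 : 0 < (M ^ n)⁻¹ / n := by positivity
    simp only [hg]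
    linarith
  have gm : c < g m := by
    have h1 : m⁻¹ ≤ (m ^ n)⁻¹ := by
      gcongr
      exact pow_le_of_le_one hm0.le hm1.le (by omega)
    rw [hm, inv_inv, ← hm] at h1
    have h2 : c < (m ^ n)⁻¹ / n := by
      rw [lt_div_iff₀ hn0]; linarith
    have h3 : 0 < m ^ (n + 1) / (n + 1) := by positivity
    simp only [hg]
    linarith
  have hcont : ContinuousOn g (Set.Ioi 0) := by
    intro x hx
    have : x ^ n ≠ 0 := pow_ne_zero _ (ne_of_gt hx)
    apply ContinuousAt.continuousWithinAt
    simp only [hg]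
    fun_prop (disch := assumption)
  obtain ⟨p, hp, ep⟩ := intermediate_value_Ioo' hm1.le
    (hcont.mono fun x hx => hm0.trans_le hx.1) ⟨g1, gm⟩
  obtain ⟨q, hq, eq⟩ := intermediate_value_Ioo hM1.le
    (hcont.mono fun x hx => one_pos.trans_le hx.1) ⟨g1, gM⟩
  have hp0 : 0 < p := hm0.trans hp.1
  have hpq : p < q := hp.2.trans hq.1
  refine ⟨p, q, hp0, hpq, fun x hx => ⟨fun h => ?_, ?_⟩⟩
  · exact hconc.eq_or_eq_of_level hp0 (hp0.trans hpq) hx hpq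
      (by rw [ep, eq]) (neg_inj.2 (h.trans eq.symm))
  · rintro (rfl | rfl)
    exacts [ep, eq]

theorem ncard_reducedEqn_real {n : ℕ} (hn : 0 < n) {c : ℝ}
    (hc : 1 / (n : ℝ) + 1 / (n + 1) < c) :
    {x : ℝ | x ≠ 0 ∧ ReducedEqn n c x}.ncard + 4 * (n / 2) = 2 * n + 1 ∧
    {x : ℝ | x ≠ 0 ∧ ReducedEqn n c x}.Finite := by
  have hn0 : (0 : ℝ) < n := by exact_mod_cast hn
  have hc0 : 0 < c := lt_trans (by positivity) hc
  obtain ⟨p, hp, hpiff⟩ := exists_unique_pos_root hn hc0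
  simp only [reducedEqn_ofReal]
  rcases Nat.even_or_odd n with he | ho
  · have : {x : ℝ | x ≠ 0 ∧ x ^ (n + 1) / (n + 1) - (x ^ n)⁻¹ / n = c} = {p} := by
      ext x
      simp only [Set.mem_ofPred_eq, Set.mem_singleton_iff]
      constructor
      · rintro ⟨hx, h⟩
        rcases lt_or_gt_of_ne hx with hneg | hpos
        · have h1 : x ^ (n + 1) < 0 := he.add_one.pow_neg hneg
          have h2 : 0 < x ^ n := he.pow_pos hx
          have h3 : x ^ (n + 1) / (n + 1) < 0 := div_neg_of_neg_of_pos h1 (by positivity)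
          have h4 : 0 < (x ^ n)⁻¹ / n := by positivity
          linarith
        · exact (hpiff x hpos).1 h
      · rintro rfl
        exact ⟨hp.ne', (hpiff x hp).2 rfl⟩
    rw [this, Set.ncard_singleton]
    obtain ⟨k, rfl⟩ := he
    exact ⟨by omega, Set.finite_singleton p⟩
  · obtain ⟨q, r, hq, hqr, hiff⟩ := exists_pair_pos_roots hn hc
    have hodd : ∀ x : ℝ, (-x) ^ (n + 1) / (n + 1) - ((-x) ^ n)⁻¹ / n =
        x ^ (n + 1) / (n + 1) + (x ^ n)⁻¹ / n := by
      intro x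
      rw [ho.add_one.neg_pow, ho.neg_pow, inv_neg]
      ring
    have : {x : ℝ | x ≠ 0 ∧ x ^ (n + 1) / (n + 1) - (x ^ n)⁻¹ / n = c} = {p, -q, -r} := by
      ext x
      simp only [Set.mem_ofPred_eq, Set.mem_singleton_iff, Set.mem_insert_iff]
      constructor
      · rintro ⟨hx, h⟩
        rcases lt_or_gt_of_ne hx with hneg | hpos
        · have h' := hodd (-x)
          rw [neg_neg] at h'
          rcases (hiff (-x) (by linarith)).1 (h'.symm.trans h) with h | h
          · exact Or.inr (Or.inl (by linarith))
          · exact Or.inr (Or.inr (by linarith))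
        · exact Or.inl ((hpiff x hpos).1 h)
      · rintro (rfl | rfl | rfl)
        · exact ⟨hp.ne', (hpiff x hp).2 rfl⟩
        · exact ⟨by linarith, (hodd q).trans ((hiff q hq).2 (Or.inl rfl))⟩
        · exact ⟨by linarith, (hodd r).trans ((hiff r (hq.trans hqr)).2 (Or.inr rfl))⟩
    rw [this, Set.ncard_eq_three.2 ⟨p, -q, -r, by linarith, by linarith,
      fun h => hqr.ne (neg_inj.1 h), rfl⟩]
    obtain ⟨k, rfl⟩ := ho
    exact ⟨by omega, Set.toFinite _⟩

theorem ncard_reducedEqn {n : ℕ} (hn : 2 ≤ n) {c : ℝ}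
    (hc : 1 / (n : ℝ) + 1 / (n + 1) < c) :
    {z : ℂ | z ≠ 0 ∧ ReducedEqn n c z}.ncard = 2 * n + 1 := by
  obtain ⟨hU, hUf⟩ := ncard_reducedEqn_upper hn hc
  obtain ⟨hR, hRf⟩ := ncard_reducedEqn_real (by omega) hc
  set U := {z : ℂ | 0 < z.im ∧ ReducedEqn n c z}
  set R := {x : ℝ | x ≠ 0 ∧ ReducedEqn n c x}
  have hconj : Function.Injective (starRingEnd ℂ) := (starRingEnd ℂ).injective
  have hL : (starRingEnd ℂ '' U).ncard = 2 * (n / 2) := by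
    rw [Set.ncard_image_of_injective _ hconj, hU]
  have hRR : (Complex.ofReal '' R).ncard = R.ncard :=
    Set.ncard_image_of_injective _ Complex.ofReal_injective
  have hsplit : {z : ℂ | z ≠ 0 ∧ ReducedEqn n c z} =
      (U ∪ starRingEnd ℂ '' U) ∪ Complex.ofReal '' R := by
    ext z
    constructor
    · rintro ⟨hz, h⟩
      rcases lt_trichotomy z.im 0 with him | him | him
      · refine Or.inl (Or.inr ⟨starRingEnd ℂ z, ⟨by simpa using him, reducedEqn_conj h⟩, ?_⟩)
        exact Complex.conj_conj z
      · have hzr : (z.re : ℂ) = z := Complex.ext (by simp) (by simp [him])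
        refine Or.inr ⟨z.re, ⟨fun h0 => hz ?_, hzr.symm ▸ h⟩, hzr⟩
        rw [← hzr, h0, Complex.ofReal_zero]
      · exact Or.inl (Or.inl ⟨him, h⟩)
    · rintro ((⟨him, h⟩ | ⟨w, ⟨him, h⟩, rfl⟩) | ⟨x, ⟨hx, h⟩, rfl⟩)
      · exact ⟨by rintro rfl; simp at him, h⟩
      · exact ⟨fun h0 => by rw [(map_eq_zero _).1 h0] at him; simp at him, reducedEqn_conj h⟩
      · exact ⟨Complex.ofReal_ne_zero.2 hx, h⟩
  have hd1 : Disjoint U (starRingEnd ℂ '' U) := by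
    rw [Set.disjoint_left]
    rintro z ⟨hz, -⟩ ⟨w, ⟨hw, -⟩, rfl⟩
    rw [Complex.conj_im] at hz
    linarith
  have hd2 : Disjoint (U ∪ starRingEnd ℂ '' U) (Complex.ofReal '' R) := by
    rw [Set.disjoint_left]
    rintro z (⟨hz, -⟩ | ⟨w, ⟨hw, -⟩, rfl⟩) ⟨x, -, hx⟩
    · rw [← hx] at hz
      simp at hz
    · have := congrArg Complex.im hx
      rw [Complex.conj_im, Complex.ofReal_im] at this
      linarith
  rw [hsplit, Set.ncard_union_eq hd2 (hUf.union (hUf.image _)) (hRf.image _),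
    Set.ncard_union_eq hd1 hUf (hUf.image _), hL, hU, hRR]
  omega

/-- For `1 < a < n(n+1)/(2n+1) − 1`, the function `f_a` has exactly `2n + 1` zeros. -/
theorem max_zeros_for_small_a (n : ℕ) (hn : 4 ≤ n) (a : ℝ) (ha : 1 < a)
    (ha' : a < (n * (n + 1) : ℝ) / (2 * n + 1) - 1) :
    {z : ℂ | z ≠ 0 ∧ fa n a z = 0}.ncard = 2 * n + 1 := by
  simp only [fa_eq_zero_iff ha]
  have hn0 : (0 : ℝ) < n := by exact_mod_cast (by omega : 0 < n)
  refine ncard_reducedEqn (by omega) ?_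
  rw [div_add_div _ _ (by positivity) (by positivity), div_lt_div_iff₀ (by positivity) (by linarith)]
  have := (lt_div_iff₀ (by positivity)).1 (lt_sub_iff_add_lt.1 ha')
  linarith
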